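/- arXiv:2211.08548 — 3 statements merged into one kernel-verified Lean document; each statement's English description precedes it below -/
import Mathlib

section
/- Let N ≥ 61 be an integer with N < n. Suppose the hyperplanes in 𝒜 are pairwise non-parallel, |S_j| = p_j (the j-th prime) for every j > N, and δ_j = 1/2 for every j with N < j ≤ n. Set M_0 = ∏_{j=1}^{N} (1 + 3/((1−δ_j)|S_j|)), c_1 = −log log p_N + 1/(log p_N)², and c_2 = 1 + 3/(2 log p_N). Then ∑_{k=N+1}^{n} w_k(B_k) ≤ (2 c_2 M_0 e^{6 c_1} / p_N) · ( (log p_N)^5 + 5 (log p_N)^4 + 20 (log p_N)^3 + 60 (log p_N)^2 + 120 log p_N + 120 ). -/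
open Finset
open scoped Classical

/-- A hyperplane in `S_1 × ⋯ × S_n`.  Coordinates are 0-indexed in Lean:
coordinate `j : ℕ`, `j < n`, corresponds to the paper's coordinate `j + 1`,
so the paper's set `S_j` is `S (j - 1)` here.  A hyperplane is recorded by its
finite set `F` of fixed coordinates together with the fixed value at each
fixed coordinate (on the non-fixed coordinates it is all of `S j`). -/
structure Hyp (S : ℕ → Type) (n : ℕ) where
  F : Finset ℕ
  hF : ∀ j ∈ F, j < n
  val : ∀ j ∈ F, S j

/-- The stage of a hyperplane: in the paper's 1-based labelling,
`A.stage = max F(A)`; in the 0-based labelling it is `(sup of A.F) + 1`. -/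
def Hyp.stage {S : ℕ → Type} {n : ℕ} (A : Hyp S n) : ℕ := A.F.sup id + 1

/-- `Qp S k` is the paper's `Q_k = S_1 × ⋯ × S_k` (in 0-based indexing,
`S 0 × ⋯ × S (k-1)`).  `Qp S 0` is a one-element type. -/
abbrev Qp (S : ℕ → Type) (k : ℕ) := ∀ j : Fin k, S j

/-- `x ∈ Q_k` lies on (the projection to `Q_k` of) the hyperplane `A`;
this is the correct notion of membership whenever `F(A) ⊆ {1, …, k}`. -/
def memH {S : ℕ → Type} {n : ℕ} (A : Hyp S n) {k : ℕ} (x : Qp S k) : Prop :=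
  ∀ (j : Fin k) (h : (j : ℕ) ∈ A.F), x j = A.val j h

/-- Membership in `B_k = ⋃_{A ∈ 𝒜_k} A`, viewed as a subset of `Q_k`, where
`𝒜_k = {A ∈ 𝒜 : max F(A) = k}` (1-based `k`). -/
def memB {S : ℕ → Type} {n : ℕ} {ι : Type} (𝓐 : ι → Hyp S n) (k : ℕ) (x : Qp S k) : Prop :=
  ∃ i, (𝓐 i).stage = k ∧ memH (𝓐 i) x

/-- `alpha 𝓐 k x` is the paper's `α_{k+1}(x)` for `x ∈ Q_k`: the proportion of
the fiber `F_x` covered by `B_{k+1}`. -/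
noncomputable def alpha {S : ℕ → Type} [∀ j, Fintype (S j)] {n : ℕ} {ι : Type}
    (𝓐 : ι → Hyp S n) (k : ℕ) (x : Qp S k) : ℝ :=
  ((univ.filter fun y : S k => memB 𝓐 (k + 1) (Fin.snoc x y)).card : ℝ) /
    (Fintype.card (S k))

/-- The weights `w_k : Q_k → ℝ`, defined inductively:  `w_0 ≡ 1`, and `w_(k+1)`
is obtained from `w_k` by the distortion rule with parameter `δ_{k+1} = δ k`.
(The paper's `δ_j` is `δ (j - 1)` here.) -/
noncomputable def w {S : ℕ → Type} [∀ j, Fintype (S j)] {n : ℕ} {ι : Type}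
    (𝓐 : ι → Hyp S n) (δ : ℕ → ℝ) : (k : ℕ) → Qp S k → ℝ
  | 0, _ => 1
  | (k + 1), x =>
      let x' : Qp S k := fun j => x j.castSucc
      let a : ℝ := alpha 𝓐 k x'
      if memB 𝓐 (k + 1) x then
        if a ≤ δ k then 0
        else ((a - δ k) / (a * (1 - δ k))) * (w 𝓐 δ k x' / (Fintype.card (S k)))
      else
        if a ≤ δ k then (1 / (1 - a)) * (w 𝓐 δ k x' / (Fintype.card (S k)))
        else (1 / (1 - δ k)) * (w 𝓐 δ k x' / (Fintype.card (S k)))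

/-- `w_k(B_k)` (1-based `k`). -/
noncomputable def wB {S : ℕ → Type} [∀ j, Fintype (S j)] {n : ℕ} {ι : Type}
    (𝓐 : ι → Hyp S n) (δ : ℕ → ℝ) (k : ℕ) : ℝ :=
  ∑ x ∈ univ.filter (memB 𝓐 k), w 𝓐 δ k x

/-- `w_k(A)`: the weight of the projection to `Q_k` of a hyperplane `A`
(meaningful when `F(A) ⊆ {1, …, k}`). -/
noncomputable def wH {S : ℕ → Type} [∀ j, Fintype (S j)] {n : ℕ} {ι : Type}
    (𝓐 : ι → Hyp S n) (δ : ℕ → ℝ) (k : ℕ) (A : Hyp S n) : ℝ :=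
  ∑ x ∈ univ.filter (fun x : Qp S k => memH A x), w 𝓐 δ k x

/-- `ν(J) = ∏_{j ∈ J} 1 / ((1 - δ_j)|S_j|)` (0-based `J`). -/
noncomputable def nu (S : ℕ → Type) [∀ j, Fintype (S j)] (δ : ℕ → ℝ) (J : Finset ℕ) : ℝ :=
  ∏ j ∈ J, 1 / ((1 - δ j) * (Fintype.card (S j)))

/-- `‖J‖ = ∏_{j ∈ J} |S_j|` (0-based `J`). -/
noncomputable def normJ (S : ℕ → Type) [∀ j, Fintype (S j)] (J : Finset ℕ) : ℝ :=
  ∏ j ∈ J, (Fintype.card (S j) : ℝ)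

/-- `Ew 𝓐 δ k` is the paper's `E_k = E_{(k+1)-1} = ∑_{x ∈ Q_k} α_{k+1}(x)² w_k(x)`. -/
noncomputable def Ew {S : ℕ → Type} [∀ j, Fintype (S j)] {n : ℕ} {ι : Type}
    (𝓐 : ι → Hyp S n) (δ : ℕ → ℝ) (k : ℕ) : ℝ :=
  ∑ x : Qp S k, (alpha 𝓐 k x) ^ 2 * w 𝓐 δ k x

open ArithmeticFunction in
theorem log_factorial_eq_sum_vonMangoldt (n N : ℕ) (h : n ≤ N) :
    Real.log (n.factorial) = ∑ d ∈ Ioc 0 N, vonMangoldt d * ((n / d : ℕ) : ℝ) := by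
  have h1 : ∀ m : ℕ, Real.log (m.factorial) = ∑ i ∈ Ioc 0 m, Real.log (i : ℕ) := by
    intro m
    induction m with
    | zero => simp
    | succ m ih =>
      rw [Finset.sum_Ioc_succ_top (Nat.zero_le m), ← ih, Nat.factorial_succ, Nat.cast_mul,
        Real.log_mul (by positivity) (by positivity), add_comm]
  rw [h1]
  have h2 : ∀ i ∈ Ioc 0 n, Real.log (i : ℕ) =
      ∑ d ∈ Ioc 0 N, if d ∣ i then vonMangoldt d else 0 := by
    intro i hi
    rw [← vonMangoldt_sum, ← Finset.sum_filter]
    apply Finset.sum_congr _ (fun _ _ => rfl)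
    ext d
    simp only [mem_Ioc] at hi
    simp only [Nat.mem_divisors, mem_filter, mem_Ioc]
    constructor
    · rintro ⟨hd, -⟩
      exact ⟨⟨Nat.pos_of_dvd_of_pos hd hi.1, (Nat.le_of_dvd hi.1 hd).trans (hi.2.trans h)⟩, hd⟩
    · rintro ⟨-, hd⟩
      exact ⟨hd, by omega⟩
  rw [Finset.sum_congr rfl h2, Finset.sum_comm]
  apply Finset.sum_congr rfl
  intro d _
  rw [← Finset.sum_filter, Finset.sum_const, Nat.Ioc_filter_dvd_card_eq_div, nsmul_eq_mul, mul_comm]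

theorem log_factorial_le (m : ℕ) (hm : 1 ≤ m) :
    Real.log m.factorial ≤ m * Real.log m - m + Real.log m + 1 := by
  induction m, hm using Nat.le_induction with
  | base => simp
  | succ m hm ih =>
    have hm' : (1 : ℝ) ≤ m := by exact_mod_cast hm
    rw [Nat.factorial_succ, Nat.cast_mul, Real.log_mul (by positivity) (by positivity)]
    push_cast
    have h1 := Real.one_sub_inv_le_log_of_pos (x := ((m : ℝ) + 1) / m) (by positivity)
    rw [Real.log_div (by positivity) (by positivity), inv_div] at h1
    have h2 : (m + 1) * (1 - (m : ℝ) / (m + 1)) = 1 := by field_simp; ring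
    nlinarith

theorem le_log_factorial (m : ℕ) (hm : 1 ≤ m) :
    m * Real.log m - m + 1 ≤ Real.log m.factorial := by
  induction m, hm using Nat.le_induction with
  | base => simp
  | succ m hm ih =>
    have hm' : (1 : ℝ) ≤ m := by exact_mod_cast hm
    rw [Nat.factorial_succ, Nat.cast_mul, Real.log_mul (by positivity) (by positivity)]
    push_cast
    have h1 := Real.log_le_sub_one_of_pos (x := ((m : ℝ) + 1) / m) (by positivity)
    rw [Real.log_div (by positivity) (by positivity)] at h1
    have h2 : m * (((m : ℝ) + 1) / m - 1) = 1 := by field_simp; ring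
    nlinarith

theorem mul_log_sub_self_mono {s t : ℝ} (hs : 1 ≤ s) (hst : s ≤ t) :
    s * Real.log s - s ≤ t * Real.log t - t := by
  have hs0 : 0 < s := by linarith
  have ht0 : 0 < t := by linarith
  have h1 := Real.one_sub_inv_le_log_of_pos (x := t / s) (by positivity)
  rw [Real.log_div (by positivity) (by positivity), inv_div] at h1
  have h2 : t * (1 - s / t) = t - s := by
    field_simp
  have h3 := Real.log_nonneg hs
  nlinarith

theorem log_factorial_div_le (n k : ℕ) (hk : 1 ≤ k) (hn : k ≤ n) :
    Real.log (n / k).factorial ≤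
      (n / k : ℝ) * Real.log (n / k) - n / k + Real.log (n / k) + 1 := by
  have h1 : 1 ≤ n / k := (Nat.one_le_div_iff hk).2 hn
  have h2 : ((n / k : ℕ) : ℝ) ≤ n / k := Nat.cast_div_le
  have h3 : (1 : ℝ) ≤ ((n / k : ℕ) : ℝ) := by exact_mod_cast h1
  have := log_factorial_le _ h1
  have := mul_log_sub_self_mono h3 h2
  have := Real.log_le_log (by positivity) h2
  linarith

theorem le_log_factorial_div (n k : ℕ) (hk : 1 ≤ k) (hn : k ≤ n) :
    (n / k : ℝ) * Real.log (n / k) - n / k + 1 - Real.log (n / k + 1) ≤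
      Real.log (n / k).factorial := by
  have hk' : (1 : ℝ) ≤ k := by exact_mod_cast hk
  have h2 : ((n / k : ℕ) : ℝ) ≤ n / k := Nat.cast_div_le
  have h3 : (n / k : ℝ) ≤ (n / k : ℕ) + 1 := by
    rw [div_le_iff₀ (by positivity)]
    have : n < (n / k + 1) * k := by
      rw [add_mul, one_mul]; exact Nat.lt_div_mul_add hk
    exact_mod_cast this.le
  have h4 : (1 : ℝ) ≤ n / k := by
    rw [le_div_iff₀ (by positivity)]; rw [one_mul]; exact_mod_cast hn
  have h5 := le_log_factorial (n / k + 1) (Nat.succ_pos _)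
  rw [Nat.factorial_succ, Nat.cast_mul, Real.log_mul (by positivity) (by positivity)] at h5
  push_cast at h5
  have h6 := mul_log_sub_self_mono h4 h3
  have h7 := Real.log_le_log (by positivity) (add_le_add_left h2 1)
  linarith

/-- The logarithm of Chebyshev's quotient `n! ⌊n/30⌋! / (⌊n/2⌋! ⌊n/3⌋! ⌊n/5⌋!)`. -/
noncomputable def chebyshevQuotientLog (n : ℕ) : ℝ :=
  Real.log n.factorial - Real.log (n / 2).factorial - Real.log (n / 3).factorial -
    Real.log (n / 5).factorial + Real.log (n / 30).factorial

theorem chebyshevQuotientLog_eq_sum (n : ℕ) :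
    chebyshevQuotientLog n = ∑ d ∈ Ioc 0 n, ArithmeticFunction.vonMangoldt d *
      (((n / d : ℕ) : ℝ) - ((n / d / 2 : ℕ) : ℝ) - ((n / d / 3 : ℕ) : ℝ) -
        ((n / d / 5 : ℕ) : ℝ) + ((n / d / 30 : ℕ) : ℝ)) := by
  have key : ∀ k, Real.log (n / k).factorial =
      ∑ d ∈ Ioc 0 n, ArithmeticFunction.vonMangoldt d * ((n / d / k : ℕ) : ℝ) := by
    intro k
    rw [log_factorial_eq_sum_vonMangoldt (n / k) n (Nat.div_le_self n k)]
    simp only [Nat.div_div_eq_div_mul, mul_comm k]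
  unfold chebyshevQuotientLog
  rw [key 2, key 3, key 5, key 30, log_factorial_eq_sum_vonMangoldt n n le_rfl,
    ← Finset.sum_sub_distrib, ← Finset.sum_sub_distrib, ← Finset.sum_sub_distrib,
    ← Finset.sum_add_distrib]
  apply Finset.sum_congr rfl
  intro d _
  ring

theorem chebyshevQuotientLog_le_psi (n : ℕ) : chebyshevQuotientLog n ≤ Chebyshev.psi n := by
  rw [chebyshevQuotientLog_eq_sum, Chebyshev.psi, Nat.floor_natCast]
  apply Finset.sum_le_sum
  intro d _
  apply mul_le_of_le_one_right ArithmeticFunction.vonMangoldt_nonneg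
  generalize n / d = m
  have : m + m / 30 ≤ 1 + m / 2 + m / 3 + m / 5 := by omega
  have : (m : ℝ) + (m / 30 : ℕ) ≤ 1 + (m / 2 : ℕ) + (m / 3 : ℕ) + (m / 5 : ℕ) := by
    exact_mod_cast this
  linarith

theorem psi_sub_psi_div_six_le (n : ℕ) :
    Chebyshev.psi n - Chebyshev.psi ((n / 6 : ℕ) : ℝ) ≤ chebyshevQuotientLog n := by
  have h6 : n / 6 ≤ n := Nat.div_le_self n 6
  rw [chebyshevQuotientLog_eq_sum, Chebyshev.psi, Chebyshev.psi, Nat.floor_natCast,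
    Nat.floor_natCast, sub_le_iff_le_add, ← Finset.sum_Ioc_consecutive _ (Nat.zero_le _) h6,
    ← Finset.sum_Ioc_consecutive _ (Nat.zero_le _) h6, add_comm]
  have hpos : ∀ m : ℕ, (0 : ℝ) ≤ (m : ℝ) - ((m / 2 : ℕ) : ℝ) - ((m / 3 : ℕ) : ℝ) -
        ((m / 5 : ℕ) : ℝ) + ((m / 30 : ℕ) : ℝ) := by
    intro m
    have : m / 2 + m / 3 + m / 5 ≤ m + m / 30 := by omega
    have : ((m / 2 : ℕ) : ℝ) + (m / 3 : ℕ) + (m / 5 : ℕ) ≤ m + (m / 30 : ℕ) := by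
      exact_mod_cast this
    linarith
  have h1 : 0 ≤ ∑ d ∈ Ioc 0 (n / 6), ArithmeticFunction.vonMangoldt d *
      (((n / d : ℕ) : ℝ) - ((n / d / 2 : ℕ) : ℝ) - ((n / d / 3 : ℕ) : ℝ) -
        ((n / d / 5 : ℕ) : ℝ) + ((n / d / 30 : ℕ) : ℝ)) :=
    Finset.sum_nonneg fun d _ => mul_nonneg ArithmeticFunction.vonMangoldt_nonneg (hpos _)
  have h2 : ∑ d ∈ Ioc (n / 6) n, ArithmeticFunction.vonMangoldt d ≤
      ∑ d ∈ Ioc (n / 6) n, ArithmeticFunction.vonMangoldt d *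
      (((n / d : ℕ) : ℝ) - ((n / d / 2 : ℕ) : ℝ) - ((n / d / 3 : ℕ) : ℝ) -
        ((n / d / 5 : ℕ) : ℝ) + ((n / d / 30 : ℕ) : ℝ)) := by
    apply Finset.sum_le_sum
    intro d hd
    rw [mem_Ioc] at hd
    apply le_mul_of_one_le_right ArithmeticFunction.vonMangoldt_nonneg
    have hd0 : 0 < d := by omega
    have h3 : n / d < 6 := by
      rw [Nat.div_lt_iff_lt_mul hd0]
      have := (Nat.div_lt_iff_lt_mul (by norm_num : 0 < 6)).1 hd.1
      linarith
    have h4 : 1 ≤ n / d := (Nat.one_le_div_iff hd0).2 hd.2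
    generalize n / d = m at h3 h4
    have : 1 + m / 2 + m / 3 + m / 5 ≤ m + m / 30 := by omega
    have : 1 + ((m / 2 : ℕ) : ℝ) + (m / 3 : ℕ) + (m / 5 : ℕ) ≤ m + (m / 30 : ℕ) := by
      exact_mod_cast this
    linarith
  linarith

/-- Chebyshev's constant `log (2^(1/2) 3^(1/3) 5^(1/5) / 30^(1/30))`. -/
noncomputable def chebyshevConst : ℝ :=
  Real.log 2 / 2 + Real.log 3 / 3 + Real.log 5 / 5 - Real.log 30 / 30

theorem log_add_one_le {t : ℝ} (ht : 1 ≤ t) : Real.log (t + 1) ≤ Real.log t + Real.log 2 := by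
  rw [← Real.log_mul (by positivity) (by positivity)]
  exact Real.log_le_log (by positivity) (by linarith)

theorem abs_chebyshevQuotientLog_sub_le (n : ℕ) (hn : 30 ≤ n) :
    |chebyshevQuotientLog n - chebyshevConst * n| ≤ 5 * Real.log n := by
  have hn' : (30 : ℝ) ≤ n := by exact_mod_cast hn
  have u := fun k (hk : 1 ≤ k) (h : k ≤ 30) => log_factorial_div_le n k hk (h.trans hn)
  have l := fun k (hk : 1 ≤ k) (h : k ≤ 30) => le_log_factorial_div n k hk (h.trans hn)
  have d : ∀ k : ℝ, 1 ≤ k → Real.log (n / k) = Real.log n - Real.log k := fun k hk =>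
    Real.log_div (by positivity) (by positivity)
  have e : ∀ k : ℝ, 1 ≤ k → k ≤ 30 →
      Real.log (n / k + 1) ≤ Real.log n - Real.log k + Real.log 2 := fun k hk hk' => by
    rw [← d k hk]
    refine log_add_one_le ?_
    rw [le_div_iff₀ (by positivity)]; linarith
  have u1 := u 1 le_rfl (by norm_num)
  have l1 := l 1 le_rfl (by norm_num)
  have u2 := u 2 (by norm_num) (by norm_num)
  have l2 := l 2 (by norm_num) (by norm_num)
  have u3 := u 3 (by norm_num) (by norm_num)
  have l3 := l 3 (by norm_num) (by norm_num)
  have u5 := u 5 (by norm_num) (by norm_num)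
  have l5 := l 5 (by norm_num) (by norm_num)
  have u30 := u 30 (by norm_num) (by norm_num)
  have l30 := l 30 (by norm_num) (by norm_num)
  have e1 := e 1 le_rfl (by norm_num)
  have e2 := e 2 (by norm_num) (by norm_num)
  have e3 := e 3 (by norm_num) (by norm_num)
  have e5 := e 5 (by norm_num) (by norm_num)
  have e30 := e 30 (by norm_num) (by norm_num)
  simp only [Nat.div_one, Nat.cast_one, div_one, Nat.cast_ofNat] at u1 l1 u2 l2 u3 l3 u5 l5 u30 l30 e1
  rw [d 2 (by norm_num)] at u2 l2
  rw [d 3 (by norm_num)] at u3 l3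
  rw [d 5 (by norm_num)] at u5 l5
  rw [d 30 (by norm_num)] at u30 l30
  have h30 : Real.log 30 = Real.log 2 + Real.log 3 + Real.log 5 := by
    rw [← Real.log_mul (by norm_num) (by norm_num), ← Real.log_mul (by norm_num) (by norm_num)]
    norm_num
  have p2 := Real.log_two_gt_d9
  have p2' := Real.log_two_lt_d9
  have p3 : Real.log 2 < Real.log 3 := Real.log_lt_log (by norm_num) (by norm_num)
  have p5 : 2 * Real.log 2 < Real.log 5 := by
    rw [← Real.log_rpow (by norm_num)]
    exact Real.log_lt_log (by norm_num) (by norm_num)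
  simp only [Real.log_one] at e1
  unfold chebyshevQuotientLog chebyshevConst
  rw [abs_le]
  constructor <;> nlinarith
theorem chebyshevConst_bounds : 0.9195 < chebyshevConst ∧ chebyshevConst < 0.9242 := by
  have h30 : Real.log 30 = Real.log 2 + Real.log 3 + Real.log 5 := by
    rw [← Real.log_mul (by norm_num) (by norm_num), ← Real.log_mul (by norm_num) (by norm_num)]
    norm_num
  have hA : 30 * chebyshevConst = Real.log (2 ^ 14 * 3 ^ 9 * 5 ^ 5) := by
    rw [Real.log_mul (by norm_num) (by norm_num), Real.log_mul (by norm_num) (by norm_num),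
      Real.log_pow, Real.log_pow, Real.log_pow]
    unfold chebyshevConst
    rw [h30]
    push_cast
    ring
  have h1 : Real.log (2 ^ 14 * 3 ^ 9 * 5 ^ 5) < 40 * Real.log 2 := by
    have := Real.log_pow (2 : ℝ) 40
    push_cast at this
    rw [← this]
    exact Real.log_lt_log (by norm_num) (by norm_num)
  have h2 : 199 * Real.log 2 < 5 * Real.log (2 ^ 14 * 3 ^ 9 * 5 ^ 5) := by
    have := Real.log_pow (2 : ℝ) 199
    have h5 := Real.log_pow (2 ^ 14 * 3 ^ 9 * 5 ^ 5 : ℝ) 5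
    push_cast at this h5
    rw [← this, ← h5]
    exact Real.log_lt_log (by norm_num) (by norm_num)
  have p2 := Real.log_two_gt_d9
  have p2' := Real.log_two_lt_d9
  constructor <;> linarith

/-- Checks `lcm(1, …, j) ≤ 3 ^ j` for `m ≤ j < m + k`, where `L = lcm(1, …, m)`. -/
def lcmCheck : ℕ → ℕ → ℕ → Bool
  | 0, _, _ => true
  | k + 1, m, L => Nat.ble L (3 ^ m) && lcmCheck k (m + 1) (Nat.lcm L (m + 1))

theorem lcmUpto_succ (m : ℕ) : Nat.lcmUpto (m + 1) = Nat.lcm (Nat.lcmUpto m) (m + 1) := by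
  unfold Nat.lcmUpto
  rw [← Finset.insert_Icc_right_eq_Icc_add_one (by omega), Finset.lcm_insert, lcm_comm]
  rfl

theorem lcmUpto_le_of_lcmCheck (k m : ℕ) (h : lcmCheck k m (Nat.lcmUpto m) = true) :
    ∀ j, m ≤ j → j < m + k → Nat.lcmUpto j ≤ 3 ^ j := by
  induction k generalizing m with
  | zero => intro j h1 h2; omega
  | succ k ih =>
    rw [lcmCheck, Bool.and_eq_true, ← lcmUpto_succ] at h
    intro j h1 h2
    rcases h1.eq_or_lt with rfl | h1
    · exact Nat.le_of_ble_eq_true h.1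
    · exact ih (m + 1) h.2 j h1 (by omega)

theorem lcmUpto_le_three_pow (j : ℕ) (hj : j < 800) : Nat.lcmUpto j ≤ 3 ^ j := by
  refine lcmUpto_le_of_lcmCheck 800 0 ?_ j (Nat.zero_le j) (by omega)
  rw [show Nat.lcmUpto 0 = 1 from rfl]
  decide +kernel

theorem psi_natCast_le (n : ℕ) : Chebyshev.psi n ≤ 7 / 6 * n := by
  induction n using Nat.strong_induction_on with
  | _ n ih =>
    rcases lt_or_ge n 800 with hn | hn
    · rw [Chebyshev.psi_eq_log_lcmUpto]
      have h1 : Real.log (Nat.lcmUpto n) ≤ Real.log ((3 : ℝ) ^ n) :=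
        Real.log_le_log (by exact_mod_cast Nat.lcmUpto_pos n)
          (by exact_mod_cast lcmUpto_le_three_pow n hn)
      have h2 : Real.log 3 ≤ 7 / 6 := by
        have h3 := Real.log_pow (3 : ℝ) 6
        have h4 := Real.log_pow (2 : ℝ) 10
        have h5 : Real.log ((3 : ℝ) ^ 6) ≤ Real.log ((2 : ℝ) ^ 10) :=
          Real.log_le_log (by norm_num) (by norm_num)
        push_cast at h3 h4
        have := Real.log_two_lt_d9
        linarith
      rw [Real.log_pow] at h1
      nlinarith [(Nat.cast_nonneg n : (0 : ℝ) ≤ n)]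
    · have h1 := psi_sub_psi_div_six_le n
      have h2 := (abs_le.1 (abs_chebyshevQuotientLog_sub_le n (by omega))).2
      have h3 := ih (n / 6) (by omega)
      have h4 : ((n / 6 : ℕ) : ℝ) ≤ n / 6 := by exact_mod_cast Nat.cast_div_le
      have hn' : (800 : ℝ) ≤ n := by exact_mod_cast hn
      have h5 := Real.log_le_sub_one_of_pos (x := (n : ℝ) / 800) (by positivity)
      rw [Real.log_div (by positivity) (by norm_num)] at h5
      have h6 : Real.log 800 ≤ 10 * Real.log 2 := by
        have := Real.log_pow (2 : ℝ) 10
        push_cast at this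
        rw [← this]
        exact Real.log_le_log (by norm_num) (by norm_num)
      have := Real.log_two_lt_d9
      have := chebyshevConst_bounds.2
      nlinarith

theorem psi_le_seven_sixths (x : ℝ) (hx : 0 ≤ x) : Chebyshev.psi x ≤ 7 / 6 * x := by
  rw [Chebyshev.psi_eq_psi_coe_floor]
  have := psi_natCast_le ⌊x⌋₊
  have := Nat.floor_le hx
  linarith

/-- Checks `9 ^ j ≤ 4 ^ j * j#` for `m ≤ j < m + k`, where `P = m#`. -/
def primorialCheck : ℕ → ℕ → ℕ → Bool
  | 0, _, _ => true
  | k + 1, m, P => (Nat.ble m 282 || Nat.ble (9 ^ m) (4 ^ m * P)) &&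
      primorialCheck k (m + 1) (bif Nat.beq (Nat.gcd (m + 1) P) 1 then (m + 1) * P else P)

theorem primorial_succ_eq_ite_gcd (m : ℕ) (hm : 1 ≤ m) :
    primorial (m + 1) =
      bif Nat.beq (Nat.gcd (m + 1) (primorial m)) 1 then (m + 1) * primorial m
      else primorial m := by
  have hp : (m + 1).Prime ↔ Nat.gcd (m + 1) (primorial m) = 1 := by
    constructor
    · intro h
      rw [← Nat.coprime_iff_gcd_eq_one, Nat.Prime.coprime_iff_not_dvd h,
        Nat.Prime.dvd_primorial_iff h]
      omega
    · intro h
      by_contra hnp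
      have h1 := Nat.minFac_prime (n := m + 1) (by omega)
      have h2 : (m + 1).minFac ≠ m + 1 := fun h => hnp (h ▸ h1)
      have h3 := Nat.minFac_le (n := m + 1) (by omega)
      have h4 := h1.dvd_primorial_iff.2 (show (m + 1).minFac ≤ m by omega)
      exact Nat.not_coprime_of_dvd_of_dvd h1.one_lt (Nat.minFac_dvd _) h4 h
  have hs : primorial (m + 1) = if (m + 1).Prime then (m + 1) * primorial m else primorial m := by
    unfold primorial
    rw [Finset.range_add_one (n := m + 1), Finset.filter_insert]
    split_ifs with h
    · rw [Finset.prod_insert (by simp)]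
    · rfl
  rw [hs]
  by_cases h : (m + 1).Prime
  · rw [if_pos h, hp.1 h]; rfl
  · rw [if_neg h]
    have : Nat.beq (Nat.gcd (m + 1) (primorial m)) 1 = false := by
      rw [← Bool.not_eq_true, Nat.beq_eq]
      exact fun h' => h (hp.2 h')
    rw [this]; rfl

theorem le_primorial_of_primorialCheck (k m : ℕ) (hm : 1 ≤ m)
    (h : primorialCheck k m (primorial m) = true) :
    ∀ j, m ≤ j → j < m + k → 283 ≤ j → 9 ^ j ≤ 4 ^ j * primorial j := by
  induction k generalizing m with
  | zero => intro j h1 h2; omega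
  | succ k ih =>
    rw [primorialCheck, Bool.and_eq_true, ← primorial_succ_eq_ite_gcd m hm, Bool.or_eq_true] at h
    intro j h1 h2 h3
    rcases h1.eq_or_lt with rfl | h1
    · rcases h.1 with h4 | h4
      · have := Nat.le_of_ble_eq_true h4
        omega
      · exact Nat.le_of_ble_eq_true h4
    · exact ih (m + 1) (by omega) h.2 j h1 (by omega) h3

theorem nine_pow_le_four_pow_mul_primorial (j : ℕ) (h1 : 283 ≤ j) (h2 : j < 1500) :
    9 ^ j ≤ 4 ^ j * primorial j := by
  refine le_primorial_of_primorialCheck 1500 1 le_rfl ?_ j (by omega) (by omega) h1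
  rw [primorial_one]
  decide +kernel

theorem le_theta_natCast (n : ℕ) (hn : 283 ≤ n) : 4 / 5 * n ≤ Chebyshev.theta n := by
  have hn0 : (0 : ℝ) ≤ n := Nat.cast_nonneg n
  rcases lt_or_ge n 1500 with h | h
  · rw [Chebyshev.theta_eq_log_primorial, Nat.floor_natCast]
    have h1 : (9 / 4 : ℝ) ^ n ≤ primorial n := by
      rw [div_pow, div_le_iff₀ (by positivity), mul_comm]
      exact_mod_cast nine_pow_le_four_pow_mul_primorial n hn h
    have h2 := Real.log_le_log (by positivity) h1
    rw [Real.log_pow] at h2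
    have h3 : 4 / 5 ≤ Real.log (9 / 4) := by
      have h3 := Real.log_pow (9 / 4 : ℝ) 6
      have h4 := Real.log_pow (2 : ℝ) 7
      have h5 : Real.log ((2 : ℝ) ^ 7) ≤ Real.log ((9 / 4 : ℝ) ^ 6) :=
        Real.log_le_log (by norm_num) (by norm_num)
      push_cast at h3 h4
      rw [h3, h4] at h5
      have := Real.log_two_gt_d9
      linarith
    nlinarith
  · have hn' : (1500 : ℝ) ≤ n := by exact_mod_cast h
    have h1 := chebyshevQuotientLog_le_psi n
    have h2 := (abs_le.1 (abs_chebyshevQuotientLog_sub_le n (by omega))).1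
    have h3 := Chebyshev.psi_sub_theta_le_psi_add_psi_add_psi n
    have hp : ∀ r : ℝ, r ≤ 2⁻¹ → Chebyshev.psi ((n : ℝ) ^ r) ≤ 7 / 6 * √n := by
      intro r hr
      refine (psi_le_seven_sixths _ (by positivity)).trans ?_
      rw [Real.sqrt_eq_rpow]
      gcongr
      · linarith
      · linarith
    have p2 := hp 2⁻¹ le_rfl
    have p3 := hp 3⁻¹ (by norm_num)
    have p5 := hp 5⁻¹ (by norm_num)
    have h5 := Real.log_le_sub_one_of_pos (x := (n : ℝ) / 1500) (by positivity)
    rw [Real.log_div (by positivity) (by norm_num)] at h5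
    have h6 : Real.log 1500 ≤ 11 * Real.log 2 := by
      have := Real.log_pow (2 : ℝ) 11
      push_cast at this
      rw [← this]
      exact Real.log_le_log (by norm_num) (by norm_num)
    have h7 : 2 * 45 * √n ≤ n + 45 ^ 2 := by
      nlinarith [sq_nonneg (√n - 45), Real.sq_sqrt hn0]
    have := Real.log_two_lt_d9
    have := chebyshevConst_bounds.1
    nlinarith
theorem theta_nth_prime_succ (j : ℕ) :
    Chebyshev.theta (Nat.nth Nat.Prime (j + 1) : ℕ) =
      Chebyshev.theta (Nat.nth Nat.Prime j : ℕ) + Real.log (Nat.nth Nat.Prime (j + 1)) := by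
  have hlt : Nat.nth Nat.Prime j < Nat.nth Nat.Prime (j + 1) :=
    Nat.nth_strictMono Nat.infinite_setOfPred_prime (Nat.lt_succ_self j)
  rw [Chebyshev.theta_eq_sum_primesLE_log, Chebyshev.theta_eq_sum_primesLE_log]
  have : Nat.primesLE (Nat.nth Nat.Prime (j + 1)) =
      insert (Nat.nth Nat.Prime (j + 1)) (Nat.primesLE (Nat.nth Nat.Prime j)) := by
    ext p
    simp only [mem_insert, Nat.mem_primesLE]
    constructor
    · rintro ⟨h1, h2⟩
      rcases h1.eq_or_lt with h | h
      · exact Or.inl h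
      · right
        refine ⟨?_, h2⟩
        by_contra! h3
        rw [← Nat.nth_count h2] at h h3
        have h4 := (Nat.nth_lt_nth Nat.infinite_setOfPred_prime).1 h
        have h5 := (Nat.nth_lt_nth Nat.infinite_setOfPred_prime).1 h3
        omega
    · rintro (rfl | ⟨h1, h2⟩)
      · exact ⟨le_rfl, Nat.prime_nth_prime _⟩
      · exact ⟨h1.trans hlt.le, h2⟩
  rw [this, Finset.sum_insert, add_comm]
  rw [Nat.mem_primesLE]
  omega

/-- Comparison of `s ∫ d(-1 / (u log u))` with `∫ u d(-1 / (u log u))` over `[s, t]`. -/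
theorem mul_inv_mul_log_sub_le {s t : ℝ} (hs : 1 < s) (hst : s ≤ t) :
    s * (1 / (s * Real.log s) - 1 / (t * Real.log t)) ≤
      (Real.log (Real.log t) - 1 / Real.log t) - (Real.log (Real.log s) - 1 / Real.log s) := by
  have hmono : MonotoneOn (fun u : ℝ => Real.log (Real.log u) - 1 / Real.log u +
      s * (1 / (u * Real.log u))) (Set.Ici s) := by
    have hpos : ∀ u ∈ Set.Ici s, 0 < u ∧ 0 < Real.log u := fun u hu =>
      ⟨by linarith [Set.mem_Ici.1 hu], Real.log_pos (lt_of_lt_of_le hs hu)⟩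
    have hder : ∀ u ∈ Set.Ici s, HasDerivAt (fun u : ℝ => Real.log (Real.log u) - 1 / Real.log u +
        s * (1 / (u * Real.log u)))
        ((u - s) * (Real.log u + 1) / (u * Real.log u) ^ 2) u := by
      intro u hu
      obtain ⟨h1, h2⟩ := hpos u hu
      have hl := Real.hasDerivAt_log h1.ne'
      have e1 := hl.log h2.ne'
      have e2 := (hasDerivAt_const u (1 : ℝ)).div hl h2.ne'
      have e3 := ((hasDerivAt_const u (1 : ℝ)).div ((hasDerivAt_id u).mul hl)
        (mul_pos h1 h2).ne').const_mul s
      refine ((e1.sub e2).add e3).congr_deriv ?_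
      simp only [id, Pi.mul_apply]
      field_simp
      ring
    apply monotoneOn_of_deriv_nonneg (convex_Ici s)
    · exact fun u hu => (hder u hu).continuousAt.continuousWithinAt
    · exact fun u hu => (hder u (interior_subset hu)).differentiableAt.differentiableWithinAt
    · intro u hu
      have hu' := interior_subset hu
      obtain ⟨h1, h2⟩ := hpos u hu'
      rw [(hder u hu').deriv]
      have : 0 ≤ u - s := sub_nonneg.2 hu'
      positivity
  have := hmono (Set.mem_Ici.2 le_rfl) (Set.mem_Ici.2 hst) hst
  simp only at this
  linarith

theorem sum_inv_nth_prime_le (N : ℕ) (m : ℕ) {a b : ℝ}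
    (ha : a * Nat.nth Nat.Prime N ≤ Chebyshev.theta (Nat.nth Nat.Prime N : ℕ))
    (hb : ∀ x : ℕ, Chebyshev.theta x ≤ b * x) (hm : N ≤ m) :
    ∑ j ∈ Finset.Ioc N m, 1 / (Nat.nth Nat.Prime j : ℝ) ≤
      (b - a) / Real.log (Nat.nth Nat.Prime N) +
        b * Real.log (Real.log (Nat.nth Nat.Prime m) / Real.log (Nat.nth Nat.Prime N)) := by
  set p : ℕ → ℝ := fun j => (Nat.nth Nat.Prime j : ℝ) with hp
  set T : ℕ → ℝ := fun j => Chebyshev.theta (Nat.nth Nat.Prime j : ℕ) with hT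
  have hgt : ∀ j, 1 < p j := fun j => by
    simp only [hp]
    exact_mod_cast (Nat.prime_nth_prime j).one_lt
  have hlog : ∀ j, 0 < Real.log (p j) := fun j => Real.log_pos (hgt j)
  have key : ∑ j ∈ Finset.Ioc N m, 1 / p j ≤
      T m * (1 / (p m * Real.log (p m))) - T N * (1 / (p N * Real.log (p N))) +
        b * ((Real.log (Real.log (p m)) - 1 / Real.log (p m)) -
          (Real.log (Real.log (p N)) - 1 / Real.log (p N))) := by
    induction m, hm using Nat.le_induction with
    | base => simp
    | succ m hm ih =>
      rw [Finset.sum_Ioc_succ_top hm]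
      have h1 : T (m + 1) = T m + Real.log (p (m + 1)) := theta_nth_prime_succ m
      have h2 : p m ≤ p (m + 1) := by
        simp only [hp]
        exact_mod_cast Nat.nth_monotone Nat.infinite_setOfPred_prime (Nat.le_succ m)
      have h3 := mul_inv_mul_log_sub_le (hgt m) h2
      have h4 : 1 / p (m + 1) = Real.log (p (m + 1)) * (1 / (p (m + 1) * Real.log (p (m + 1)))) := by
        have := (hlog (m + 1)).ne'
        have := (hgt (m + 1)).le
        have h0 : p (m + 1) ≠ 0 := by positivity
        field_simp
      have h5 : T m ≤ b * p m := hb _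
      have h6 : 1 / (p (m + 1) * Real.log (p (m + 1))) ≤ 1 / (p m * Real.log (p m)) := by
        have := hlog m
        have := hgt m
        have h0 : 0 < p m := by linarith
        apply one_div_le_one_div_of_le (by positivity)
        have := Real.log_le_log h0 h2
        gcongr
      have hb0 : 0 ≤ b := by
        have := hb 1
        simp only [Nat.cast_one, mul_one, Chebyshev.theta_one] at this
        exact this
      have h7 : T m * (1 / (p m * Real.log (p m)) - 1 / (p (m + 1) * Real.log (p (m + 1)))) ≤
          b * p m * (1 / (p m * Real.log (p m)) - 1 / (p (m + 1) * Real.log (p (m + 1)))) :=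
        mul_le_mul_of_nonneg_right h5 (sub_nonneg.2 h6)
      have h8 := mul_le_mul_of_nonneg_left h3 hb0
      rw [h1, h4]
      linarith
  refine key.trans ?_
  have hp0 : ∀ j, 0 < p j := fun j => by linarith [hgt j]
  have h1 : T m * (1 / (p m * Real.log (p m))) ≤ b * (1 / Real.log (p m)) := by
    have h5 : T m ≤ b * p m := hb _
    have := hlog m
    have := hp0 m
    calc _ ≤ b * p m * (1 / (p m * Real.log (p m))) := by gcongr
      _ = _ := by field_simp
  have h2 : a * (1 / Real.log (p N)) ≤ T N * (1 / (p N * Real.log (p N))) := by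
    have h5 : a * p N ≤ T N := ha
    have := hlog N
    have := hp0 N
    calc _ = a * p N * (1 / (p N * Real.log (p N))) := by field_simp
      _ ≤ _ := by gcongr
  rw [Real.log_div (hlog m).ne' (hlog N).ne', sub_div, div_eq_mul_one_div b, div_eq_mul_one_div a]
  linarith

/-- `∫_t^∞ (log u)^7 / u^2 du`. -/
noncomputable def logPowTail (t : ℝ) : ℝ :=
  (Real.log t ^ 7 + 7 * Real.log t ^ 6 + 42 * Real.log t ^ 5 + 210 * Real.log t ^ 4 +
    840 * Real.log t ^ 3 + 2520 * Real.log t ^ 2 + 5040 * Real.log t + 5040) / t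

theorem log_pow_mul_sub_le_logPowTail_sub {s t : ℝ} (hs : 1 < s) (hst : s ≤ t) :
    Real.log s ^ 7 * (1 / s - 1 / t) ≤ logPowTail s - logPowTail t := by
  have hanti : AntitoneOn (fun u : ℝ => logPowTail u - Real.log s ^ 7 * (1 / u)) (Set.Ici s) := by
    have hpos : ∀ u ∈ Set.Ici s, 0 < u ∧ Real.log s ≤ Real.log u := fun u hu =>
      ⟨by linarith [Set.mem_Ici.1 hu], Real.log_le_log (by linarith) hu⟩
    have hder : ∀ u ∈ Set.Ici s, HasDerivAt
        (fun u : ℝ => logPowTail u - Real.log s ^ 7 * (1 / u))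
        (-((Real.log u ^ 7 - Real.log s ^ 7) / u ^ 2)) u := by
      intro u hu
      obtain ⟨h1, -⟩ := hpos u hu
      have hl := Real.hasDerivAt_log h1.ne'
      have e1 := (((((((hl.pow 7).add ((hl.pow 6).const_mul 7)).add ((hl.pow 5).const_mul 42)).add
        ((hl.pow 4).const_mul 210)).add ((hl.pow 3).const_mul 840)).add
        ((hl.pow 2).const_mul 2520)).add (hl.const_mul 5040)).add_const 5040
      have e2 := e1.div (hasDerivAt_id u) h1.ne'
      have e3 := ((hasDerivAt_const u (1 : ℝ)).div (hasDerivAt_id u) h1.ne').const_mul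
        (Real.log s ^ 7)
      refine (e2.sub e3).congr_deriv ?_
      simp only [id, Pi.add_apply, Pi.pow_apply]
      field_simp
      ring
    apply antitoneOn_of_deriv_nonpos (convex_Ici s)
    · exact fun u hu => (hder u hu).continuousAt.continuousWithinAt
    · exact fun u hu => (hder u (interior_subset hu)).differentiableAt.differentiableWithinAt
    · intro u hu
      have hu' := interior_subset hu
      obtain ⟨h1, h2⟩ := hpos u hu'
      rw [(hder u hu').deriv, neg_nonpos]
      have h3 : Real.log s ^ 7 ≤ Real.log u ^ 7 :=
        pow_le_pow_left₀ (Real.log_pos hs).le h2 7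
      exact div_nonneg (sub_nonneg.2 h3) (by positivity)
  have := hanti (Set.mem_Ici.2 le_rfl) (Set.mem_Ici.2 hst) hst
  simp only at this
  linarith

theorem log_pow_div_le_logPowTail {t : ℝ} (ht : 1 < t) : Real.log t ^ 7 / t ≤ logPowTail t := by
  have := Real.log_pos ht
  unfold logPowTail
  gcongr
  have : 0 ≤ 7 * Real.log t ^ 6 + 42 * Real.log t ^ 5 + 210 * Real.log t ^ 4 +
    840 * Real.log t ^ 3 + 2520 * Real.log t ^ 2 + 5040 * Real.log t + 5040 := by positivity
  linarith
theorem exp_mul_poly_sub_one_le {s : ℝ} (h0 : 0 ≤ s) (h1 : s ≤ 1 / 5) :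
    Real.exp (11 / 5 * s) * (1 + 7 * s + 42 * s ^ 2 + 210 * s ^ 3 + 840 * s ^ 4 + 2520 * s ^ 5 +
      5040 * s ^ 6 + 5040 * s ^ 7) - 1 ≤
    12 * (1 + 3 / 2 * s) * Real.exp (6 * s ^ 2) *
      (s + 5 * s ^ 2 + 20 * s ^ 3 + 60 * s ^ 4 + 120 * s ^ 5 + 120 * s ^ 6) := by
  have e1 := Real.exp_bound' (x := 11 / 5 * s) (by positivity) (by linarith) (n := 4) (by norm_num)
  simp only [Finset.sum_range_succ, Finset.sum_range_zero, Nat.factorial] at e1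
  norm_num at e1
  have e2 := Real.quadratic_le_exp_of_nonneg (x := 6 * s ^ 2) (by positivity)
  have hR : 12 * (1 + 3 / 2 * s) * (1 + 6 * s ^ 2 + (6 * s ^ 2) ^ 2 / 2) *
      (s + 5 * s ^ 2 + 20 * s ^ 3 + 60 * s ^ 4 + 120 * s ^ 5 + 120 * s ^ 6) ≤
      12 * (1 + 3 / 2 * s) * Real.exp (6 * s ^ 2) *
      (s + 5 * s ^ 2 + 20 * s ^ 3 + 60 * s ^ 4 + 120 * s ^ 5 + 120 * s ^ 6) := by
    gcongr
  have hL := mul_le_mul_of_nonneg_right e1 (show 0 ≤ 1 + 7 * s + 42 * s ^ 2 + 210 * s ^ 3 +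
    840 * s ^ 4 + 2520 * s ^ 5 + 5040 * s ^ 6 + 5040 * s ^ 7 by positivity)
  refine le_trans ?_ hR
  have h2 : s ^ 2 ≤ 1 / 25 := by nlinarith
  have h3 : 0 ≤ s ^ 3 := by positivity
  have h5 : s ^ 5 ≤ s ^ 3 / 25 := by nlinarith
  have h6 : s ^ 6 ≤ s ^ 3 / 125 := by nlinarith
  have h7 : s ^ 7 ≤ s ^ 3 / 625 := by nlinarith
  have h8 : 0 ≤ s ^ 8 := by positivity
  have h9 : 0 ≤ s ^ 9 := by positivity
  have h10 : 0 ≤ s ^ 10 := by positivity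
  have h11 : 0 ≤ s ^ 11 := by positivity
  have h4 : 0 ≤ s ^ 4 := by positivity
  have hs2 : 0 ≤ s ^ 2 := by positivity
  linarith

theorem prod_one_add_six_div_prime_le (M m : ℕ) (hM : 283 ≤ Nat.nth Nat.Prime M) (hm : M ≤ m) :
    ∏ j ∈ Finset.Ioc M m, (1 + 6 / (Nat.nth Nat.Prime j : ℝ)) ≤
      Real.exp (11 / 5 * (1 / Real.log (Nat.nth Nat.Prime M))) *
        (Real.log (Nat.nth Nat.Prime m) / Real.log (Nat.nth Nat.Prime M)) ^ 7 := by
  have hlog : ∀ j, 0 < Real.log (Nat.nth Nat.Prime j) := fun j =>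
    Real.log_pos (by exact_mod_cast (Nat.prime_nth_prime j).one_lt)
  have h1 := sum_inv_nth_prime_le M m (a := 4 / 5) (b := 7 / 6) (le_theta_natCast _ hM)
    (fun x => (Chebyshev.theta_le_psi _).trans (psi_natCast_le x)) hm
  have hr : 0 < Real.log (Nat.nth Nat.Prime m) / Real.log (Nat.nth Nat.Prime M) :=
    div_pos (hlog m) (hlog M)
  calc ∏ j ∈ Finset.Ioc M m, (1 + 6 / (Nat.nth Nat.Prime j : ℝ))
      ≤ ∏ j ∈ Finset.Ioc M m, Real.exp (6 / (Nat.nth Nat.Prime j : ℝ)) := by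
        apply Finset.prod_le_prod
        · intros; positivity
        · intro j _
          rw [add_comm]
          exact Real.add_one_le_exp _
    _ = Real.exp (6 * ∑ j ∈ Finset.Ioc M m, 1 / (Nat.nth Nat.Prime j : ℝ)) := by
        rw [← Real.exp_sum, Finset.mul_sum]
        simp only [mul_one_div]
    _ ≤ Real.exp (11 / 5 * (1 / Real.log (Nat.nth Nat.Prime M)) +
          Real.log ((Real.log (Nat.nth Nat.Prime m) / Real.log (Nat.nth Nat.Prime M)) ^ 7)) := by
        rw [Real.exp_le_exp, Real.log_pow]
        push_cast
        rw [div_eq_mul_one_div] at h1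
        linarith
    _ = _ := by rw [Real.exp_add, Real.exp_log (by positivity)]

theorem sum_prod_div_sq_le (M m : ℕ) (hM : 283 ≤ Nat.nth Nat.Prime M) (hm : M ≤ m) :
    6 * ∑ i ∈ Finset.Ico M m, (∏ j ∈ Finset.Ioc M i, (1 + 6 / (Nat.nth Nat.Prime j : ℝ))) /
        (Nat.nth Nat.Prime (i + 1) : ℝ) ^ 2 ≤
      Real.exp (11 / 5 * (1 / Real.log (Nat.nth Nat.Prime M))) /
        Real.log (Nat.nth Nat.Prime M) ^ 7 * logPowTail (Nat.nth Nat.Prime M) -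
        1 / (Nat.nth Nat.Prime M : ℝ) := by
  set p : ℕ → ℝ := fun j => (Nat.nth Nat.Prime j : ℝ) with hp
  set P : ℕ → ℝ := fun i => ∏ j ∈ Finset.Ioc M i, (1 + 6 / p j) with hP
  have hgt : ∀ j, 1 < p j := fun j => by
    simp only [hp]
    exact_mod_cast (Nat.prime_nth_prime j).one_lt
  set K : ℝ := Real.exp (11 / 5 * (1 / Real.log (p M))) / Real.log (p M) ^ 7 with hK
  have hPK : ∀ i, M ≤ i → P i ≤ K * Real.log (p i) ^ 7 := by
    intro i hi
    refine (prod_one_add_six_div_prime_le M i hM hi).trans_eq ?_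
    rw [div_pow, hK]
    ring
  have hK0 : 0 ≤ K := by
    have := Real.log_pos (hgt M)
    positivity
  have key : 6 * ∑ i ∈ Finset.Ico M m, P i / p (i + 1) ^ 2 ≤
      P m / p m - 1 / p M + K * (logPowTail (p M) - logPowTail (p m)) := by
    induction m, hm using Nat.le_induction with
    | base => simp [hP]
    | succ m hm ih =>
      rw [Finset.sum_Ico_succ_top hm]
      have h2 : p m ≤ p (m + 1) := by
        simp only [hp]
        exact_mod_cast Nat.nth_monotone Nat.infinite_setOfPred_prime (Nat.le_succ m)
      have h3 := mul_le_mul_of_nonneg_left (log_pow_mul_sub_le_logPowTail_sub (hgt m) h2) hK0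
      have hpm := hgt m
      have hpm1 := hgt (m + 1)
      have h4 : 0 ≤ 1 / p m - 1 / p (m + 1) :=
        sub_nonneg.2 (one_div_le_one_div_of_le (by linarith) h2)
      have h5 := mul_le_mul_of_nonneg_right (hPK m hm) h4
      have h6 : P (m + 1) = P m * (1 + 6 / p (m + 1)) := Finset.prod_Ioc_succ_top hm _
      have h7 : P (m + 1) / p (m + 1) = P m / p (m + 1) + 6 * (P m / p (m + 1) ^ 2) := by
        rw [h6]
        have : p (m + 1) ≠ 0 := by positivity
        field_simp
      rw [h7]
      rw [mul_sub, mul_one_div, mul_one_div] at h5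
      linarith
  have h1 : P m / p m ≤ K * logPowTail (p m) := by
    have h2 := mul_le_mul_of_nonneg_left (log_pow_div_le_logPowTail (hgt m)) hK0
    have h3 := hPK m hm
    have := hgt m
    calc P m / p m ≤ K * Real.log (p m) ^ 7 / p m := by gcongr
      _ ≤ _ := by rw [mul_div_assoc]; exact h2
  linarith

theorem nth_prime_ge_283 (M : ℕ) (hM : 60 ≤ M) : 283 ≤ Nat.nth Nat.Prime M := by
  have h1 : Nat.nth Nat.Prime 60 = 283 := by
    have h2 : Nat.count Nat.Prime 283 = 60 := by decide +kernel
    rw [← h2]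
    exact Nat.nth_count (by norm_num)
  rw [← h1]
  exact Nat.nth_monotone Nat.infinite_setOfPred_prime hM

theorem five_le_log {x : ℝ} (hx : 283 ≤ x) : 5 ≤ Real.log x := by
  rw [Real.le_log_iff_exp_le (by linarith)]
  have h1 := Real.exp_one_lt_d9
  have h2 : Real.exp 5 = Real.exp 1 ^ 5 := by rw [← Real.exp_nat_mul]; norm_num
  rw [h2]
  calc Real.exp 1 ^ 5 ≤ 2.7182818286 ^ 5 := by gcongr
    _ ≤ x := by norm_num; linarith

theorem sum_prod_div_sq_le_closed_form (M m : ℕ) (hM : 60 ≤ M) (hm : M ≤ m) {pN L : ℝ}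
    (hpN : pN = Nat.nth Nat.Prime M) (hL : L = Real.log pN) :
    ∑ i ∈ Finset.Ico M m, (∏ j ∈ Finset.Ioc M i, (1 + 6 / (Nat.nth Nat.Prime j : ℝ))) /
        (Nat.nth Nat.Prime (i + 1) : ℝ) ^ 2 ≤
      2 * (1 + 3 / (2 * L)) * Real.exp (6 * (-Real.log L + 1 / L ^ 2)) / pN *
        (L ^ 5 + 5 * L ^ 4 + 20 * L ^ 3 + 60 * L ^ 2 + 120 * L + 120) := by
  have h283 := nth_prime_ge_283 M hM
  have h1 := sum_prod_div_sq_le M m h283 hm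
  rw [← hpN, ← hL] at h1
  have hx : (283 : ℝ) ≤ pN := by rw [hpN]; exact_mod_cast h283
  have hL5 : 5 ≤ L := hL ▸ five_le_log hx
  have hL0 : 0 < L := by linarith
  have hp0 : 0 < pN := by linarith
  have h2 := exp_mul_poly_sub_one_le (s := 1 / L) (by positivity)
    (one_div_le_one_div_of_le (by norm_num) hL5)
  have h3 : Real.exp (6 * (-Real.log L + 1 / L ^ 2)) = Real.exp (6 * (1 / L) ^ 2) / L ^ 6 := by
    rw [show 6 * (-Real.log L + 1 / L ^ 2) = 6 * (1 / L) ^ 2 - Real.log (L ^ 6) by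
      rw [Real.log_pow]; push_cast; ring, Real.exp_sub, Real.exp_log (by positivity)]
  rw [h3]
  have h4 := div_le_div_of_nonneg_right h2 hp0.le
  have h5 : (Real.exp (11 / 5 * (1 / L)) / L ^ 7 * logPowTail pN - 1 / pN) =
      (Real.exp (11 / 5 * (1 / L)) * (1 + 7 * (1 / L) + 42 * (1 / L) ^ 2 + 210 * (1 / L) ^ 3 +
        840 * (1 / L) ^ 4 + 2520 * (1 / L) ^ 5 + 5040 * (1 / L) ^ 6 + 5040 * (1 / L) ^ 7) - 1) /
        pN := by
    unfold logPowTail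
    rw [← hL]
    field_simp
  rw [h5] at h1
  have h6 : 12 * (1 + 3 / 2 * (1 / L)) * Real.exp (6 * (1 / L) ^ 2) *
      (1 / L + 5 * (1 / L) ^ 2 + 20 * (1 / L) ^ 3 + 60 * (1 / L) ^ 4 + 120 * (1 / L) ^ 5 +
        120 * (1 / L) ^ 6) / pN =
      6 * (2 * (1 + 3 / (2 * L)) * (Real.exp (6 * (1 / L) ^ 2) / L ^ 6) / pN *
        (L ^ 5 + 5 * L ^ 4 + 20 * L ^ 3 + 60 * L ^ 2 + 120 * L + 120)) := by
    generalize Real.exp (6 * (1 / L) ^ 2) = E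
    field_simp
    ring
  rw [h6] at h4
  linarith

theorem Hyp.mem_F_of_stage_eq {S : ℕ → Type} {n : ℕ} {A : Hyp S n}
    (hA : A.F.Nonempty) {k : ℕ} (h : A.stage = k + 1) :
    k ∈ A.F := by
  obtain ⟨j, hj, hjk⟩ := Finset.exists_mem_eq_sup A.F hA id
  have : A.F.sup id = k := by simpa [Hyp.stage] using h
  rw [this] at hjk
  rwa [hjk]

theorem Hyp.F_subset_of_stage_eq {S : ℕ → Type} {n : ℕ} {A : Hyp S n} {k : ℕ}
    (h : A.stage = k + 1) :
    A.F ⊆ range (k + 1) := by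
  intro j hj
  have h1 : A.F.sup id = k := by simpa [Hyp.stage] using h
  have := Finset.le_sup (f := id) hj
  rw [h1] at this
  simpa [Nat.lt_succ_iff] using this

section Weights

variable {S : ℕ → Type} [∀ j, Fintype (S j)] {n : ℕ} {ι : Type}

theorem sum_Qp_succ {k : ℕ} (f : Qp S (k + 1) → ℝ) :
    ∑ x, f x = ∑ x : Qp S k, ∑ y : S k, f (Fin.snoc x y) := by
  rw [← Fintype.sum_prod_type_right' (f := fun (y : S k) (x : Qp S k) => f (Fin.snoc x y))]
  exact (Fintype.sum_equiv (Fin.snocEquiv fun i : Fin (k + 1) => S i) _ _ fun _ => rfl).symm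

theorem alpha_nonneg (𝓐 : ι → Hyp S n) (k : ℕ) (x : Qp S k) : 0 ≤ alpha 𝓐 k x := by
  unfold alpha; positivity

theorem w_snoc (𝓐 : ι → Hyp S n) (δ : ℕ → ℝ) (k : ℕ) (x : Qp S k) (y : S k) :
    w 𝓐 δ (k + 1) (Fin.snoc x y) =
      if memB 𝓐 (k + 1) (Fin.snoc x y : Qp S (k + 1)) then
        if alpha 𝓐 k x ≤ δ k then 0
        else ((alpha 𝓐 k x - δ k) / (alpha 𝓐 k x * (1 - δ k))) *
          (w 𝓐 δ k x / (Fintype.card (S k)))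
      else
        if alpha 𝓐 k x ≤ δ k then (1 / (1 - alpha 𝓐 k x)) * (w 𝓐 δ k x / (Fintype.card (S k)))
        else (1 / (1 - δ k)) * (w 𝓐 δ k x / (Fintype.card (S k))) := by
  have h : (fun j : Fin k => (Fin.snoc x y : Qp S (k + 1)) j.castSucc) = x :=
    funext fun j => Fin.snoc_castSucc (α := fun i : Fin (k + 1) => S i) y x j
  simp only [w, h]

/-- Summing over a fibre a function taking the value `b` on `B_{k+1}` and `c` off it. -/
theorem sum_fiber_ite (𝓐 : ι → Hyp S n) {k : ℕ} (hS : 0 < Fintype.card (S k)) (x : Qp S k)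
    (b c : ℝ) :
    ∑ y : S k, (if memB 𝓐 (k + 1) (Fin.snoc x y : Qp S (k + 1)) then b else c) =
      Fintype.card (S k) * (alpha 𝓐 k x * b + (1 - alpha 𝓐 k x) * c) := by
  have h0 : (Fintype.card (S k) : ℝ) ≠ 0 := by positivity
  have h1 : ((univ.filter fun y : S k => memB 𝓐 (k + 1) (Fin.snoc x y : Qp S (k + 1))).card : ℝ) =
      Fintype.card (S k) * alpha 𝓐 k x := by
    unfold alpha; field_simp
  have h2 := Finset.card_filter_add_card_filter_not (s := (univ : Finset (S k)))
    (fun y : S k => memB 𝓐 (k + 1) (Fin.snoc x y : Qp S (k + 1)))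
  rw [Finset.card_univ, ← @Nat.cast_inj ℝ, Nat.cast_add, h1] at h2
  rw [Finset.sum_ite, Finset.sum_const, Finset.sum_const, nsmul_eq_mul, nsmul_eq_mul, h1]
  linear_combination c * h2

theorem w_snoc_nonneg_and_le (𝓐 : ι → Hyp S n) {δ : ℕ → ℝ} {k : ℕ}
    (hδ : δ k ∈ Set.Icc (0 : ℝ) (1 / 2)) (x : Qp S k) (y : S k) (hw : 0 ≤ w 𝓐 δ k x) :
    0 ≤ w 𝓐 δ (k + 1) (Fin.snoc x y) ∧
      w 𝓐 δ (k + 1) (Fin.snoc x y) ≤ 1 / ((1 - δ k) * Fintype.card (S k)) * w 𝓐 δ k x := by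
  obtain ⟨h0, h1⟩ := hδ
  have ha := alpha_nonneg 𝓐 k x
  have hr : 1 / ((1 - δ k) * Fintype.card (S k)) * w 𝓐 δ k x =
      1 / (1 - δ k) * (w 𝓐 δ k x / Fintype.card (S k)) := by
    rw [one_div, mul_inv]; ring
  have hq : 0 ≤ w 𝓐 δ k x / Fintype.card (S k) := by positivity
  have hd : 0 < 1 - δ k := by linarith
  rw [w_snoc, hr]
  split_ifs with _ h h
  · exact ⟨le_rfl, by positivity⟩
  · push Not at h
    have hap : 0 < alpha 𝓐 k x := by linarith
    refine ⟨mul_nonneg (div_nonneg (by linarith) (by positivity)) hq, ?_⟩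
    gcongr ?_ * _
    rw [div_le_div_iff₀ (by positivity) hd]
    nlinarith
  · have : 0 < 1 - alpha 𝓐 k x := by linarith
    exact ⟨by positivity, by gcongr⟩
  · exact ⟨by positivity, le_rfl⟩

theorem w_nonneg (𝓐 : ι → Hyp S n) {δ : ℕ → ℝ}
    (hδ : ∀ j, j < n → δ j ∈ Set.Icc (0 : ℝ) (1 / 2)) {k : ℕ} (hk : k ≤ n) (x : Qp S k) :
    0 ≤ w 𝓐 δ k x := by
  induction k with
  | zero => simp [w]
  | succ k ih =>
    rw [← Fin.snoc_init_self x]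
    exact (w_snoc_nonneg_and_le 𝓐 (hδ k hk) (Fin.init x) _ (ih (by omega) _)).1

/-- The distortion preserves the mass of each fibre. -/
theorem sum_w_snoc (𝓐 : ι → Hyp S n) {δ : ℕ → ℝ} {k : ℕ} (hS : 0 < Fintype.card (S k))
    (hδ : δ k ∈ Set.Icc (0 : ℝ) (1 / 2)) (x : Qp S k) :
    ∑ y : S k, w 𝓐 δ (k + 1) (Fin.snoc x y) = w 𝓐 δ k x := by
  obtain ⟨h0, h1⟩ := hδ
  have hS' : (Fintype.card (S k) : ℝ) ≠ 0 := by positivity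
  simp only [w_snoc]
  rw [sum_fiber_ite 𝓐 hS]
  split_ifs with h
  · have : 1 - alpha 𝓐 k x ≠ 0 := by linarith
    field_simp
    ring
  · push Not at h
    have : 1 - δ k ≠ 0 := by linarith
    have : alpha 𝓐 k x ≠ 0 := by linarith
    field_simp
    ring

theorem wB_succ_le_Ew (𝓐 : ι → Hyp S n) {δ : ℕ → ℝ}
    (hδ : ∀ j, j < n → δ j ∈ Set.Icc (0 : ℝ) (1 / 2)) {k : ℕ} (hk : k < n)
    (hS : 0 < Fintype.card (S k)) (hδk : δ k = 1 / 2) :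
    wB 𝓐 δ (k + 1) ≤ Ew 𝓐 δ k := by
  unfold wB Ew
  rw [Finset.sum_filter, sum_Qp_succ]
  refine Finset.sum_le_sum fun x _ => ?_
  have hw := w_nonneg 𝓐 hδ hk.le x
  have hS' : (Fintype.card (S k) : ℝ) ≠ 0 := by positivity
  have hite : ∀ y : S k, (if memB 𝓐 (k + 1) (Fin.snoc x y : Qp S (k + 1)) then
      w 𝓐 δ (k + 1) (Fin.snoc x y) else 0) =
      if memB 𝓐 (k + 1) (Fin.snoc x y : Qp S (k + 1)) then
        (if alpha 𝓐 k x ≤ δ k then 0 else ((alpha 𝓐 k x - δ k) / (alpha 𝓐 k x * (1 - δ k))) *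
          (w 𝓐 δ k x / (Fintype.card (S k)))) else 0 := by
    intro y
    rw [w_snoc]
    split_ifs <;> rfl
  rw [Finset.sum_congr rfl fun y _ => hite y, sum_fiber_ite 𝓐 hS]
  split_ifs with h
  · simp only [mul_zero, add_zero]; positivity
  · push Not at h
    rw [hδk] at h ⊢
    have : alpha 𝓐 k x ≠ 0 := by linarith
    calc _ = (2 * alpha 𝓐 k x - 1) * w 𝓐 δ k x := by field_simp; ring
      _ ≤ _ := by
        gcongr
        nlinarith [sq_nonneg (alpha 𝓐 k x - 1)]

/-- The weight of a box whose `j`-th side has at most one element for every `j ∈ J`. -/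
theorem sum_w_box_le (𝓐 : ι → Hyp S n) {δ : ℕ → ℝ}
    (hδ : ∀ j, j < n → δ j ∈ Set.Icc (0 : ℝ) (1 / 2)) (hS : ∀ j, j < n → 0 < Fintype.card (S j))
    (c : ∀ j, S j → Prop) (J : Finset ℕ) (hc : ∀ j ∈ J, ∀ y y', c j y → c j y' → y = y')
    {k : ℕ} (hk : k ≤ n) :
    ∑ x : Qp S k, (if ∀ j : Fin k, c j (x j) then w 𝓐 δ k x else 0) ≤
      ∏ j ∈ range k, if j ∈ J then 1 / ((1 - δ j) * Fintype.card (S j)) else 1 := by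
  induction k with
  | zero => simp [w]
  | succ k ih =>
    have hkn : k < n := hk
    have hν : 0 ≤ 1 / ((1 - δ k) * (Fintype.card (S k) : ℝ)) := by
      have := (hδ k hkn).2
      have : 0 ≤ 1 - δ k := by linarith
      positivity
    have hsnoc : ∀ (x : Qp S k) (y : S k),
        (∀ j : Fin (k + 1), c j ((Fin.snoc x y : Qp S (k + 1)) j)) ↔
          (∀ j : Fin k, c j (x j)) ∧ c k y := by
      intro x y
      rw [Fin.forall_fin_succ']
      have h1 : ∀ j : Fin k, (Fin.snoc x y : Qp S (k + 1)) j.castSucc = x j := fun j =>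
        Fin.snoc_castSucc (α := fun i : Fin (k + 1) => S i) y x j
      have h2 : (Fin.snoc x y : Qp S (k + 1)) (Fin.last k) = y :=
        Fin.snoc_last (α := fun i : Fin (k + 1) => S i) y x
      simp only [h1, h2]
      rfl
    rw [sum_Qp_succ, Finset.prod_range_succ]
    refine le_trans ?_ (mul_le_mul_of_nonneg_right (ih hkn.le) (by split_ifs <;> positivity))
    rw [Finset.sum_mul]
    refine Finset.sum_le_sum fun x _ => ?_
    have hw := w_nonneg 𝓐 hδ hkn.le x
    simp only [hsnoc]
    by_cases hx : ∀ j : Fin k, c j (x j)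
    · simp only [hx, implies_true, true_and, if_true]
      have hpt := fun y => w_snoc_nonneg_and_le 𝓐 (hδ k hkn) x y hw
      split_ifs with hJ
      · by_cases hy : ∃ y, c k y
        · obtain ⟨y, hy⟩ := hy
          rw [Finset.sum_eq_single y]
          · rw [if_pos hy, mul_comm]
            exact (hpt y).2
          · intro y' _ hne
            exact if_neg fun h => hne (hc k hJ _ _ h hy)
          · simp
        · push Not at hy
          simp only [hy, if_false, Finset.sum_const_zero]
          positivity
      · rw [mul_one]
        refine le_trans (Finset.sum_le_sum fun y _ => ?_) (sum_w_snoc 𝓐 (hS k hkn) (hδ k hkn) x).le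
        split_ifs
        · exact le_rfl
        · exact (hpt y).1
    · simp [hx]

theorem sum_w_memH_and_memH_le (𝓐 : ι → Hyp S n) {δ : ℕ → ℝ}
    (hδ : ∀ j, j < n → δ j ∈ Set.Icc (0 : ℝ) (1 / 2)) (hS : ∀ j, j < n → 0 < Fintype.card (S j))
    (A A' : Hyp S n) {k : ℕ} (hk : k ≤ n) :
    ∑ x : Qp S k, (if memH A x ∧ memH A' x then w 𝓐 δ k x else 0) ≤
      ∏ j ∈ range k, if j ∈ A.F ∪ A'.F then 1 / ((1 - δ j) * Fintype.card (S j)) else 1 := by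
  have h := sum_w_box_le 𝓐 hδ hS
    (fun j y => (∀ h : j ∈ A.F, y = A.val j h) ∧ ∀ h : j ∈ A'.F, y = A'.val j h) (A.F ∪ A'.F)
    (fun j hj y y' hy hy' => by
      rcases Finset.mem_union.1 hj with hj | hj
      · rw [hy.1 hj, hy'.1 hj]
      · rw [hy.2 hj, hy'.2 hj]) hk
  refine le_trans (le_of_eq ?_) h
  congr! 2 with x
  simp only [memH, forall_and]

theorem alpha_le_sum (𝓐 : ι → Hyp S n) [Fintype ι] (hFne : ∀ i, (𝓐 i).F.Nonempty) (k : ℕ)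
    (x : Qp S k) :
    alpha 𝓐 k x ≤ (∑ i with (𝓐 i).stage = k + 1, if memH (𝓐 i) x then (1 : ℝ) else 0) /
      Fintype.card (S k) := by
  unfold alpha
  gcongr
  have hsub : (univ.filter fun y : S k => memB 𝓐 (k + 1) (Fin.snoc x y : Qp S (k + 1))) ⊆
      (univ.filter fun i => (𝓐 i).stage = k + 1).biUnion fun i =>
        univ.filter fun y : S k => memH (𝓐 i) (Fin.snoc x y : Qp S (k + 1)) := by
    intro y hy
    obtain ⟨i, hi, hm⟩ := (Finset.mem_filter.1 hy).2
    simp only [Finset.mem_biUnion, Finset.mem_filter, Finset.mem_univ, true_and]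
    exact ⟨i, hi, hm⟩
  have hcard : ∀ i ∈ univ.filter fun i => (𝓐 i).stage = k + 1,
      ((univ.filter fun y : S k => memH (𝓐 i) (Fin.snoc x y : Qp S (k + 1))).card : ℝ) ≤
        if memH (𝓐 i) x then 1 else 0 := by
    intro i hi
    have hk := Hyp.mem_F_of_stage_eq (hFne i) (Finset.mem_filter.1 hi).2
    split_ifs with hx
    · rw [Nat.cast_le_one, Finset.card_le_one]
      have hlast : ∀ y : S k, memH (𝓐 i) (Fin.snoc x y : Qp S (k + 1)) →
          y = (𝓐 i).val k hk := fun y hy =>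
        (Fin.snoc_last (α := fun i : Fin (k + 1) => S i) y x).symm.trans (hy (Fin.last k) hk)
      intro y hy y' hy'
      rw [hlast y (Finset.mem_filter.1 hy).2, hlast y' (Finset.mem_filter.1 hy').2]
    · refine le_of_eq (Nat.cast_eq_zero.2 ?_)
      rw [Finset.card_eq_zero, Finset.filter_eq_empty_iff]
      refine fun y _ hy => hx fun j hj => ?_
      exact (Fin.snoc_castSucc (α := fun i : Fin (k + 1) => S i) y x j).symm.trans
        (hy j.castSucc hj)
  calc _ ≤ (((univ.filter fun i => (𝓐 i).stage = k + 1).biUnion fun i =>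
        univ.filter fun y : S k => memH (𝓐 i) (Fin.snoc x y : Qp S (k + 1))).card : ℝ) := by
        exact_mod_cast Finset.card_le_card hsub
    _ ≤ ∑ i with (𝓐 i).stage = k + 1,
        ((univ.filter fun y : S k => memH (𝓐 i) (Fin.snoc x y : Qp S (k + 1))).card : ℝ) := by
        exact_mod_cast Finset.card_biUnion_le
    _ ≤ _ := Finset.sum_le_sum hcard

end Weights

theorem sum_powerset_sum_powerset_prod_ite (s : Finset ℕ) (ν : ℕ → ℝ) :
    ∑ I ∈ s.powerset, ∑ I' ∈ s.powerset, ∏ j ∈ s, (if j ∈ I ∪ I' then ν j else 1) =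
      ∏ j ∈ s, (1 + 3 * ν j) := by
  induction s using Finset.induction_on with
  | empty => simp
  | insert a s ha ih =>
    have key : ∀ I ∈ s.powerset, ∀ I' ∈ s.powerset,
        a ∉ I ∧ a ∉ I' ∧ (∀ j ∈ s, j ≠ a) := fun I hI I' hI' =>
      ⟨fun h => ha (Finset.mem_powerset.1 hI h), fun h => ha (Finset.mem_powerset.1 hI' h),
        fun j hj h => ha (h ▸ hj)⟩
    rw [Finset.prod_insert ha, ← ih, Finset.sum_powerset_insert ha, ← Finset.sum_add_distrib,
      Finset.mul_sum]
    refine Finset.sum_congr rfl fun I hI => ?_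
    rw [Finset.sum_powerset_insert ha, Finset.sum_powerset_insert ha, ← Finset.sum_add_distrib,
      ← Finset.sum_add_distrib, ← Finset.sum_add_distrib, Finset.mul_sum]
    refine Finset.sum_congr rfl fun I' hI' => ?_
    obtain ⟨h1, h2, h3⟩ := key I hI I' hI'
    have h4 : ∀ K K' : Finset ℕ, (∀ j ∈ s, (j ∈ K ↔ j ∈ I) ∧ (j ∈ K' ↔ j ∈ I')) →
        ∏ j ∈ s, (if j ∈ K ∪ K' then ν j else 1) = ∏ j ∈ s, (if j ∈ I ∪ I' then ν j else 1) := by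
      intro K K' hK
      refine Finset.prod_congr rfl fun j hj => ?_
      simp only [Finset.mem_union, (hK j hj).1, (hK j hj).2]
    rw [Finset.prod_insert ha, Finset.prod_insert ha, Finset.prod_insert ha, Finset.prod_insert ha,
      h4 I (insert a I'), h4 (insert a I) I', h4 (insert a I) (insert a I')]
    · simp [h1, h2]; ring
    all_goals
      intro j hj
      simp [h3 j hj]

section Weights

variable {S : ℕ → Type} [∀ j, Fintype (S j)] {n : ℕ} {ι : Type} [Fintype ι]

/-- Second moment bound for pairwise non-parallel hyperplanes. -/
theorem Ew_le (𝓐 : ι → Hyp S n) {δ : ℕ → ℝ}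
    (hδ : ∀ j, j < n → δ j ∈ Set.Icc (0 : ℝ) (1 / 2)) (hS : ∀ j, j < n → 0 < Fintype.card (S j))
    (hFne : ∀ i, (𝓐 i).F.Nonempty) (hpar : ∀ i i', (𝓐 i).F = (𝓐 i').F → i = i')
    {k : ℕ} (hk : k < n) :
    Ew 𝓐 δ k ≤
      (∏ j ∈ range k, (1 + 3 / ((1 - δ j) * Fintype.card (S j)))) / (Fintype.card (S k) : ℝ) ^ 2 := by
  set T : Finset ι := univ.filter fun i => (𝓐 i).stage = k + 1 with hT
  set ν : ℕ → ℝ := fun j => 1 / ((1 - δ j) * Fintype.card (S j)) with hν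
  set G : Finset ℕ → Finset ℕ → ℝ := fun I I' => ∏ j ∈ range k, if j ∈ I ∪ I' then ν j else 1
    with hG
  have hG0 : ∀ I I', 0 ≤ G I I' := fun I I' => Finset.prod_nonneg fun j hj => by
    have := (hδ j ((Finset.mem_range.1 hj).trans hk)).2
    have : 0 ≤ 1 - δ j := by linarith
    split_ifs <;> positivity
  have hinj : Set.InjOn (fun i => (𝓐 i).F.erase k) T := by
    intro i hi i' hi' h
    have h1 := Hyp.mem_F_of_stage_eq (hFne i) (Finset.mem_filter.1 hi).2
    have h2 := Hyp.mem_F_of_stage_eq (hFne i') (Finset.mem_filter.1 hi').2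
    refine hpar i i' ?_
    rw [← Finset.insert_erase h1, ← Finset.insert_erase h2]
    exact congrArg _ h
  have himg : T.image (fun i => (𝓐 i).F.erase k) ⊆ (range k).powerset := by
    intro I hI
    obtain ⟨i, hi, rfl⟩ := Finset.mem_image.1 hI
    refine Finset.mem_powerset.2 fun j hj => ?_
    have := Hyp.F_subset_of_stage_eq (Finset.mem_filter.1 hi).2 (Finset.mem_of_mem_erase hj)
    have := Finset.ne_of_mem_erase hj
    simp only [Finset.mem_range] at *
    omega
  have hsum : ∀ f : Finset ℕ → ℝ, (∀ I, 0 ≤ f I) →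
      ∑ i ∈ T, f ((𝓐 i).F.erase k) ≤ ∑ I ∈ (range k).powerset, f I := fun f hf => by
    rw [← Finset.sum_image (f := f) hinj]
    exact Finset.sum_le_sum_of_subset_of_nonneg himg fun I _ _ => hf I
  have hGe : ∀ i i', G (𝓐 i).F (𝓐 i').F = G ((𝓐 i).F.erase k) ((𝓐 i').F.erase k) := by
    intro i i'
    refine Finset.prod_congr rfl fun j hj => ?_
    have : j ≠ k := (Finset.mem_range.1 hj).ne
    simp [this]
  have hsq : ∀ x : Qp S k, alpha 𝓐 k x ^ 2 * w 𝓐 δ k x ≤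
      (∑ i ∈ T, ∑ i' ∈ T, if memH (𝓐 i) x ∧ memH (𝓐 i') x then w 𝓐 δ k x else 0) /
        (Fintype.card (S k) : ℝ) ^ 2 := by
    intro x
    have hw := w_nonneg 𝓐 hδ hk.le x
    calc alpha 𝓐 k x ^ 2 * w 𝓐 δ k x
        ≤ ((∑ i ∈ T, if memH (𝓐 i) x then (1 : ℝ) else 0) / Fintype.card (S k)) ^ 2 *
            w 𝓐 δ k x := by
          gcongr
          · exact alpha_nonneg 𝓐 k x
          · exact alpha_le_sum 𝓐 hFne k x
      _ = _ := by
          rw [div_pow, sq (∑ i ∈ T, _), Finset.sum_mul_sum, div_mul_eq_mul_div, Finset.sum_mul]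
          congr 1
          refine Finset.sum_congr rfl fun i _ => ?_
          rw [Finset.sum_mul]
          refine Finset.sum_congr rfl fun i' _ => ?_
          by_cases h1 : memH (𝓐 i) x <;> by_cases h2 : memH (𝓐 i') x <;> simp [h1, h2]
  calc Ew 𝓐 δ k ≤ ∑ x : Qp S k,
        (∑ i ∈ T, ∑ i' ∈ T, if memH (𝓐 i) x ∧ memH (𝓐 i') x then w 𝓐 δ k x else 0) /
          (Fintype.card (S k) : ℝ) ^ 2 := Finset.sum_le_sum fun x _ => hsq x
    _ = (∑ i ∈ T, ∑ i' ∈ T, ∑ x : Qp S k,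
          if memH (𝓐 i) x ∧ memH (𝓐 i') x then w 𝓐 δ k x else 0) /
          (Fintype.card (S k) : ℝ) ^ 2 := by
        rw [← Finset.sum_div, Finset.sum_comm]
        congr 1
        exact Finset.sum_congr rfl fun i _ => Finset.sum_comm
    _ ≤ (∑ I ∈ (range k).powerset, ∑ I' ∈ (range k).powerset, G I I') /
          (Fintype.card (S k) : ℝ) ^ 2 := by
        gcongr ?_ / _
        calc _ ≤ ∑ i ∈ T, ∑ i' ∈ T, G ((𝓐 i).F.erase k) ((𝓐 i').F.erase k) :=
              Finset.sum_le_sum fun i _ => Finset.sum_le_sum fun i' _ =>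
                (sum_w_memH_and_memH_le 𝓐 hδ hS _ _ hk.le).trans_eq (hGe i i')
          _ ≤ ∑ i ∈ T, ∑ I' ∈ (range k).powerset, G ((𝓐 i).F.erase k) I' :=
              Finset.sum_le_sum fun i _ => hsum _ (hG0 _)
          _ ≤ _ := hsum (fun I => ∑ I' ∈ (range k).powerset, G I I') fun I =>
              Finset.sum_nonneg fun I' _ => hG0 I I'
    _ = _ := by
        rw [sum_powerset_sum_powerset_prod_ite]
        simp only [hν, mul_one_div]

end Weights

/-- **Lemma 6 (tail estimate).**  Let `N ≥ 61` with `N < n`.  Suppose the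
hyperplanes of `𝒜` are pairwise non-parallel, `|S_j| = p_j` (the `j`-th prime)
for every `j > N`, and `δ_j = 1/2` for `N < j ≤ n` (all 1-based; in our
0-based indexing, `card (S j) = Nat.nth Nat.Prime j` and `δ j = 1/2` for
`N ≤ j < n`, and `p_N = Nat.nth Nat.Prime (N - 1)`).  With
`M₀ = ∏_{j=1}^{N} (1 + 3/((1-δ_j)|S_j|))`,
`c₁ = −log log p_N + 1/(log p_N)²` and `c₂ = 1 + 3/(2 log p_N)`:
`∑_{k=N+1}^{n} w_k(B_k) ≤ (2 c₂ M₀ e^{6 c₁}/p_N) ((log p_N)⁵ + 5 (log p_N)⁴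
  + 20 (log p_N)³ + 60 (log p_N)² + 120 log p_N + 120)`. -/
theorem tail_sum_wB_le
    (S : ℕ → Type) [∀ j, Fintype (S j)] (n : ℕ) (hn : 0 < n)
    (hcard : ∀ j, j < n → 2 ≤ Fintype.card (S j))
    (δ : ℕ → ℝ) (hδ : ∀ j, j < n → δ j ∈ Set.Icc (0 : ℝ) (1 / 2))
    (ι : Type) [Fintype ι] (𝓐 : ι → Hyp S n)
    (hFne : ∀ i, (𝓐 i).F.Nonempty)
    (hpar : ∀ i i', (𝓐 i).F = (𝓐 i').F → i = i')
    (N : ℕ) (hN : 61 ≤ N) (hNn : N < n)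
    (hSp : ∀ j, N ≤ j → j < n → Fintype.card (S j) = Nat.nth Nat.Prime j)
    (hδhalf : ∀ j, N ≤ j → j < n → δ j = 1 / 2) :
    letI pN : ℝ := (Nat.nth Nat.Prime (N - 1) : ℝ)
    letI M₀ : ℝ := ∏ j ∈ Finset.range N, (1 + 3 / ((1 - δ j) * (Fintype.card (S j))))
    letI c₁ : ℝ := -Real.log (Real.log pN) + 1 / (Real.log pN) ^ 2
    letI c₂ : ℝ := 1 + 3 / (2 * Real.log pN)
    ∑ k ∈ Finset.Icc (N + 1) n, wB 𝓐 δ k ≤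
      (2 * c₂ * M₀ * Real.exp (6 * c₁) / pN) *
        ((Real.log pN) ^ 5 + 5 * (Real.log pN) ^ 4 + 20 * (Real.log pN) ^ 3 +
          60 * (Real.log pN) ^ 2 + 120 * Real.log pN + 120) := by
  obtain ⟨M, rfl⟩ : ∃ M, N = M + 1 := ⟨N - 1, by omega⟩
  obtain ⟨m, rfl⟩ : ∃ m, n = m + 1 := ⟨n - 1, by omega⟩
  rw [Nat.add_sub_cancel]
  set M₀ : ℝ := ∏ j ∈ Finset.range (M + 1),
    (1 + 3 / ((1 - δ j) * (Fintype.card (S j))))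
  have hS : ∀ j, j < m + 1 → 0 < Fintype.card (S j) := fun j hj => by have := hcard j hj; omega
  have hM₀ : 0 ≤ M₀ := Finset.prod_nonneg fun j hj => by
    have := (hδ j (by have := Finset.mem_range.1 hj; omega)).2
    have : 0 ≤ 1 - δ j := by linarith
    positivity
  have hterm : ∀ i ∈ Finset.Ico M m, wB 𝓐 δ (i + 1 + 1) ≤
      M₀ * ((∏ j ∈ Finset.Ioc M i, (1 + 6 / (Nat.nth Nat.Prime j : ℝ))) /
        (Nat.nth Nat.Prime (i + 1) : ℝ) ^ 2) := by
    intro i hi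
    obtain ⟨hMi, him⟩ := Finset.mem_Ico.1 hi
    have hi' : i + 1 < m + 1 := by omega
    refine (wB_succ_le_Ew 𝓐 hδ hi' (hS _ hi') (hδhalf _ (by omega) hi')).trans
      ((Ew_le 𝓐 hδ hS hFne hpar hi').trans_eq ?_)
    rw [hSp (i + 1) (by omega) hi', mul_div_assoc',
      ← Finset.prod_range_mul_prod_Ico _ (show M + 1 ≤ i + 1 by omega),
      show Finset.Ioc M i = Finset.Ico (M + 1) (i + 1) by ext; simp]
    congr 2
    refine Finset.prod_congr rfl fun j hj => ?_
    obtain ⟨hj1, hj2⟩ := Finset.mem_Ico.1 hj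
    rw [hSp j hj1 (by omega), hδhalf j hj1 (by omega)]
    have : (Nat.nth Nat.Prime j : ℝ) ≠ 0 := by
      exact_mod_cast (Nat.prime_nth_prime j).ne_zero
    field_simp
    norm_num
  calc ∑ k ∈ Finset.Icc (M + 1 + 1) (m + 1), wB 𝓐 δ k
      = ∑ i ∈ Finset.Ico M m, wB 𝓐 δ (i + 1 + 1) := by
        rw [Finset.sum_Ico_add' (fun k => wB 𝓐 δ k) M m 2]
        refine Finset.sum_congr ?_ fun _ _ => rfl
        ext
        simp only [Finset.mem_Icc, Finset.mem_Ico]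
        omega
    _ ≤ M₀ * ∑ i ∈ Finset.Ico M m, (∏ j ∈ Finset.Ioc M i, (1 + 6 / (Nat.nth Nat.Prime j : ℝ))) /
        (Nat.nth Nat.Prime (i + 1) : ℝ) ^ 2 := by
        rw [Finset.mul_sum]
        exact Finset.sum_le_sum hterm
    _ ≤ M₀ * _ := mul_le_mul_of_nonneg_left
        (sum_prod_div_sq_le_closed_form M m (by omega) (by omega) rfl rfl) hM₀
    _ = _ := by ring
end

section
/- Let x ≡ a_j (mod m_j), 1 ≤ j ≤ r, be a covering system, let 0 ≤ k < r, set M = m_1 m_2 ⋯ m_k, and suppose a is an integer such that no integer congruent to a modulo M satisfies any of the congruences x ≡ a_j (mod m_j) with 1 ≤ j ≤ k. Then for every integer b, every integer n with n ≡ b (mod M) satisfies n ≡ a_j − a + b (mod m_j) for at least one j with k+1 ≤ j ≤ r. -/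
/-- Let `x ≡ a j (mod m j)`, `j : Fin r`, be a covering system, let
`0 ≤ k < r`, let `M = m 0 * ⋯ * m (k-1)` (so `M = 1` when `k = 0`), and suppose
`A` is an integer such that no integer congruent to `A` modulo `M` satisfies
any of the first `k` congruences.  Then for every integer `b`, every integer
`x ≡ b (mod M)` satisfies `x ≡ a j - A + b (mod m j)` for at least one `j`
with `k ≤ j < r` (1-based: `k + 1 ≤ j + 1 ≤ r`). -/
theorem shifted_tail_congruences_cover_class
    (r k : ℕ) (hk : k < r) (a : Fin r → ℤ) (m : Fin r → ℕ) (hpos : ∀ j, 0 < m j)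
    (hcov : ∀ x : ℤ, ∃ j, x ≡ a j [ZMOD (m j)])
    (A : ℤ)
    (hA : ∀ x : ℤ,
      x ≡ A [ZMOD ((∏ j ∈ Finset.univ.filter (fun j : Fin r => (j : ℕ) < k), m j : ℕ) : ℤ)] →
      ∀ j : Fin r, (j : ℕ) < k → ¬ x ≡ a j [ZMOD (m j)]) :
    ∀ b x : ℤ,
      x ≡ b [ZMOD ((∏ j ∈ Finset.univ.filter (fun j : Fin r => (j : ℕ) < k), m j : ℕ) : ℤ)] →
      ∃ j : Fin r, k ≤ (j : ℕ) ∧ x ≡ a j - A + b [ZMOD (m j)] := by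
  intro b x hx
  obtain ⟨j, hj⟩ := hcov (x - b + A)
  refine ⟨j, ?_, ?_⟩
  · by_contra! hjk
    exact hA (x - b + A) (by simpa using (hx.sub_right b).add_right A) j hjk hj
  · have h := (hj.sub_right A).add_right b
    rwa [add_sub_cancel_right, sub_add_cancel] at h
end

section
/- The system of congruences n ≡ 0 (mod 2), n ≡ 0 (mod 3), n ≡ 0 (mod 5), n ≡ 1 (mod 6), n ≡ 0 (mod 7), n ≡ 1 (mod 10), n ≡ 1 (mod 14), n ≡ 2 (mod 15), n ≡ 2 (mod 21), n ≡ 23 (mod 30), n ≡ 4 (mod 35), n ≡ 5 (mod 42), n ≡ 59 (mod 70), n ≡ 104 (mod 105) is a covering system: every integer n satisfies at least one of these fourteen congruences (and the fourteen moduli are distinct squarefree integers). -/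
/-- Every residue modulo `210` satisfies one of the fourteen congruences. -/
theorem residues_covered : ∀ r < 210,
    r % 2 = 0 ∨ r % 3 = 0 ∨ r % 5 = 0 ∨ r % 6 = 1 ∨ r % 7 = 0 ∨ r % 10 = 1 ∨ r % 14 = 1 ∨
    r % 15 = 2 ∨ r % 21 = 2 ∨ r % 30 = 23 ∨ r % 35 = 4 ∨ r % 42 = 5 ∨ r % 70 = 59 ∨
    r % 105 = 104 := by
  decide +kernel

/-- Erdős's example: the fourteen congruences below, whose moduli are the
distinct squarefree integers `2, 3, 5, 6, 7, 10, 14, 15, 21, 30, 35, 42, 70,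
105`, form a covering system of the integers. -/
theorem erdos_squarefree_covering :
    (∀ n : ℤ,
      n ≡ 0 [ZMOD 2] ∨ n ≡ 0 [ZMOD 3] ∨ n ≡ 0 [ZMOD 5] ∨ n ≡ 1 [ZMOD 6] ∨
      n ≡ 0 [ZMOD 7] ∨ n ≡ 1 [ZMOD 10] ∨ n ≡ 1 [ZMOD 14] ∨ n ≡ 2 [ZMOD 15] ∨
      n ≡ 2 [ZMOD 21] ∨ n ≡ 23 [ZMOD 30] ∨ n ≡ 4 [ZMOD 35] ∨ n ≡ 5 [ZMOD 42] ∨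
      n ≡ 59 [ZMOD 70] ∨ n ≡ 104 [ZMOD 105]) ∧
    ([2, 3, 5, 6, 7, 10, 14, 15, 21, 30, 35, 42, 70, 105] : List ℕ).Nodup ∧
    (∀ m ∈ ([2, 3, 5, 6, 7, 10, 14, 15, 21, 30, 35, 42, 70, 105] : List ℕ), Squarefree m) := by
  refine ⟨fun n ↦ ?_, by decide, ?_⟩
  · obtain ⟨r, hr⟩ := Int.eq_ofNat_of_zero_le (Int.emod_nonneg n (b := 210) (by norm_num))
    simp only [Int.ModEq]
    refine Or.imp ?_ ?_ (residues_covered r (by omega))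
    on_goal 2 => repeat' refine Or.imp ?_ ?_
    all_goals intro h; omega
  · decide +kernel
end
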